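/- arXiv:1811.05086 — 2 statements merged into one kernel-verified Lean document; each statement's English description precedes it below -/
import Mathlib

section
/- Fix c ∈ {0, N}. Any zero-mean Gaussian sequence [x_k] governed by a CM_c model is a CM_c sequence. -/
open MeasureTheory ProbabilityTheory

variable {Ω : Type*}

/-- The σ-field generated by the random variables `x k`, `k ∈ S`. -/
noncomputable def sigmaOf [MeasurableSpace Ω] {d : ℕ} (x : ℕ → Ω → (Fin d → ℝ)) (S : Set ℕ) :
    MeasurableSpace Ω :=
  ⨆ k ∈ S, MeasurableSpace.comap (x k) inferInstance

lemma sigmaOf_le [m : MeasurableSpace Ω] {d : ℕ} {x : ℕ → Ω → (Fin d → ℝ)}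
    (hx : ∀ k, Measurable (x k)) (S : Set ℕ) : sigmaOf x S ≤ m :=
  iSup_le fun k => iSup_le fun _ => (hx k).comap_le

/-- `[x_k]` is `CM_c` over `[0,N]` (`CM_F` for `c = 0`, `CM_L` for `c = N`): for every
`j ∈ [0,N]`, the σ-fields generated by `{x_k : k ∈ [j+1,N]} \ {x_c}` and by
`{x_k : k ∈ [0,j-1]} \ {x_c}` are conditionally independent given `σ(x_j, x_c)`. -/
def IsCM [MeasurableSpace Ω] [StandardBorelSpace Ω] {d : ℕ} (N c : ℕ)
    (P : Measure Ω) [IsFiniteMeasure P]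
    (x : ℕ → Ω → (Fin d → ℝ)) (hx : ∀ k, Measurable (x k)) : Prop :=
  ∀ j ≤ N, CondIndep (sigmaOf x {j, c})
    (sigmaOf x {k | j < k ∧ k ≤ N ∧ k ≠ c})
    (sigmaOf x {k | k < j ∧ k ≠ c})
    (sigmaOf_le hx _) P

/-- A random vector is (jointly) Gaussian iff every linear functional of it has a
(possibly degenerate) one-dimensional Gaussian distribution (Cramér–Wold). -/
def IsGaussianVec {ι : Type*} [Fintype ι] [MeasurableSpace Ω]
    (X : Ω → (ι → ℝ)) (P : Measure Ω) : Prop :=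
  ∀ a : ι → ℝ, ∃ (mu : ℝ) (v : NNReal),
    Measure.map (fun ω => ∑ i, a i * X ω i) P = gaussianReal mu v

/-- The stacked vector `(x_0', …, x_N')' ∈ ℝ^{(N+1)d}` of the sequence. -/
def stacked {d : ℕ} (N : ℕ) [MeasurableSpace Ω] (x : ℕ → Ω → (Fin d → ℝ)) (ω : Ω) :
    Fin (N + 1) × Fin d → ℝ :=
  fun p => x p.1 ω p.2

/-- The sequence `[x_k]` is governed by a `CM_c` model with parameters `A k = G_{k,k-1}`,
`B k = G_{k,c}`, `G0N = G_{0,N}`, noise `[e_k]` (jointly Gaussian with `[x_k]`) and noise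
covariances `G k`. -/
def GovernedBy {d : ℕ} (N c : ℕ) [MeasurableSpace Ω] (P : Measure Ω)
    (x : ℕ → Ω → (Fin d → ℝ))
    (A B : ℕ → Matrix (Fin d) (Fin d) ℝ) (G0N : Matrix (Fin d) (Fin d) ℝ)
    (e : ℕ → Ω → (Fin d → ℝ)) (G : ℕ → Matrix (Fin d) (Fin d) ℝ) : Prop :=
  -- the noise `[e_k]` is jointly Gaussian,
  IsGaussianVec (fun ω => Sum.elim (stacked N x ω) (stacked N e ω)) P ∧
  -- zero-mean,
  (∀ k ≤ N, ∀ a, ∫ ω, e k ω a ∂P = 0) ∧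
  -- white (pairwise uncorrelated),
  (∀ k ≤ N, ∀ j ≤ N, k ≠ j → ∀ a b, ∫ ω, e k ω a * e j ω b ∂P = 0) ∧
  -- with positive definite covariances `Cov(e_k) = G k`,
  (∀ k ≤ N, (∀ a b, ∫ ω, e k ω a * e k ω b ∂P = G k a b) ∧ (G k).PosDef) ∧
  -- dynamics: `x_k = G_{k,k-1} x_{k-1} + G_{k,c} x_c + e_k` for `k ∈ [1,N] \ {c}`,
  (∀ k, 1 ≤ k → k ≤ N → k ≠ c → ∀ ω,
    x k ω = (A k).mulVec (x (k - 1) ω) + (B k).mulVec (x c ω) + e k ω) ∧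
  -- boundary conditions
  (c = 0 → x 0 = e 0) ∧
  (c = N → x N = e N ∧ ∀ ω, x 0 ω = G0N.mulVec (x N ω) + e 0 ω)

open scoped Matrix

/-- Adjoining to the conditioning σ-field information independent of the "past" `m₂` yields
a σ-field that is conditionally independent of the past. -/
lemma condIndep_sup_of_indep {m' m₁ m₂ : MeasurableSpace Ω} [mΩ : MeasurableSpace Ω]
    [StandardBorelSpace Ω] (hm' : m' ≤ mΩ) (hm₁ : m₁ ≤ mΩ) (hm₂ : m₂ ≤ mΩ) (hle : m' ≤ m₂)
    (P : Measure Ω) [IsProbabilityMeasure P] (hind : Indep m₁ m₂ P) :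
    CondIndep m' (m' ⊔ m₁) m₂ hm' P := by
  have key : ∀ B C, MeasurableSet[m₁] B → MeasurableSet[m₂] C →
      P⟦C ∩ B | m'⟧ =ᵐ[P] P.real B • P⟦C | m'⟧ := by
    intro B C hB hC
    have h1 : P⟦C ∩ B | m₂⟧ =ᵐ[P] P.real B • C.indicator (fun _ => (1 : ℝ)) := by
      rw [← Set.indicator_indicator]
      refine (condExp_indicator ((integrable_const (1 : ℝ)).indicator (hm₁ _ hB)) hC).trans ?_
      have h2 := condExp_indep_eq (μ := P) hm₁ hm₂
        (f := B.indicator (fun _ => (1 : ℝ))) (stronglyMeasurable_const.indicator hB) hind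
      filter_upwards [h2] with ω hω
      by_cases hωC : ω ∈ C
      · simp [hωC, hω, integral_indicator_const, hm₁ _ hB]
      · simp [hωC]
    calc P⟦C ∩ B | m'⟧ =ᵐ[P] P[P⟦C ∩ B | m₂⟧ | m'] := (condExp_condExp_of_le hle hm₂).symm
      _ =ᵐ[P] P[P.real B • C.indicator (fun _ => (1 : ℝ)) | m'] := condExp_congr_ae h1
      _ =ᵐ[P] P.real B • P⟦C | m'⟧ := condExp_smul _ _ _
  let p : Set (Set Ω) :=
    {t | ∃ A B, MeasurableSet[m'] A ∧ MeasurableSet[m₁] B ∧ t = A ∩ B}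
  have hp : IsPiSystem p := by
    rintro _ ⟨A, B, hA, hB, rfl⟩ _ ⟨A', B', hA', hB', rfl⟩ -
    exact ⟨A ∩ A', B ∩ B', hA.inter hA', hB.inter hB', Set.inter_inter_inter_comm _ _ _ _⟩
  have hgen : m' ⊔ m₁ = MeasurableSpace.generateFrom p := by
    apply le_antisymm
    · refine sup_le (fun A hA => ?_) (fun B hB => ?_)
      · exact MeasurableSpace.measurableSet_generateFrom
          ⟨A, Set.univ, hA, MeasurableSet.univ, (Set.inter_univ _).symm⟩
      · exact MeasurableSpace.measurableSet_generateFrom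
          ⟨Set.univ, B, MeasurableSet.univ, hB, (Set.univ_inter _).symm⟩
    · refine MeasurableSpace.generateFrom_le ?_
      rintro _ ⟨A, B, hA, hB, rfl⟩
      exact MeasurableSet.inter ((le_sup_left : m' ≤ m' ⊔ m₁) _ hA)
        ((le_sup_right : m₁ ≤ m' ⊔ m₁) _ hB)
  refine CondIndepSets.condIndep (sup_le hm' hm₁) hm₂ hp
    (@MeasurableSpace.isPiSystem_measurableSet _ m₂) hgen
    (@MeasurableSpace.generateFrom_measurableSet _ m₂).symm ?_
  rw [condIndepSets_iff]
  · rintro _ C ⟨A, B, hA, hB, rfl⟩ hC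
    have hBC := key B C hB hC
    have hB1 := key B Set.univ hB MeasurableSet.univ
    have e1 : P⟦(A ∩ B) ∩ C | m'⟧ =ᵐ[P] A.indicator (P⟦C ∩ B | m'⟧) := by
      rw [Set.inter_assoc, ← Set.indicator_indicator, Set.inter_comm B C]
      exact condExp_indicator
        ((integrable_const (1 : ℝ)).indicator ((hm₂ _ hC).inter (hm₁ _ hB))) hA
    have e2 : P⟦A ∩ B | m'⟧ =ᵐ[P] A.indicator (P⟦Set.univ ∩ B | m'⟧) := by
      rw [← Set.indicator_indicator, Set.univ_inter]
      exact condExp_indicator ((integrable_const (1 : ℝ)).indicator (hm₁ _ hB)) hA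
    have e3 : P⟦Set.univ | m'⟧ = fun _ => (1 : ℝ) := by
      rw [Set.indicator_univ, condExp_const hm']
    filter_upwards [hBC, hB1, e1, e2] with ω h1 h2 h3 h4
    rw [Pi.mul_apply, h3, h4]
    by_cases hω : ω ∈ A
    · simp only [Set.indicator_of_mem hω, h1, h2, Pi.smul_apply, e3, smul_eq_mul, mul_one]
    · simp only [Set.indicator_of_notMem hω, zero_mul]
  · rintro _ ⟨A, B, hA, hB, rfl⟩
    exact (hm' _ hA).inter (hm₁ _ hB)
  · exact fun s hs => hm₂ _ hs

/-- The defining Cramér–Wold condition gives Mathlib's notion of a Gaussian law. -/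
lemma IsGaussianVec.hasGaussianLaw {ι : Type*} [Fintype ι] [MeasurableSpace Ω]
    {X : Ω → (ι → ℝ)} {P : Measure Ω} (hX : IsGaussianVec X P) (hm : Measurable X) :
    HasGaussianLaw X P := by
  classical
  refine ⟨⟨fun L => ?_⟩⟩
  have hL : ∀ v : ι → ℝ, L v = ∑ i, L (Pi.single i 1) * v i := by
    intro v
    conv_lhs => rw [← Finset.univ_sum_single v]
    rw [map_sum]
    refine Finset.sum_congr rfl fun i _ => ?_
    rw [mul_comm, ← smul_eq_mul, ← map_smul, ← Pi.single_smul, smul_eq_mul, mul_one]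
  obtain ⟨mu, v, h⟩ := hX fun i => L (Pi.single i 1)
  have hmap : (P.map X).map L = gaussianReal mu v := by
    rw [Measure.map_map (by fun_prop) hm, ← h]
    congr 1
    funext ω
    exact hL _
  generalize P.map X = ν at hmap
  have hid : ν[L] = mu := by
    rw [← integral_id_gaussianReal (μ := mu) (v := v), ← hmap]
    exact (integral_map (f := fun y : ℝ => y) (by fun_prop) (by fun_prop)).symm
  have hvar : Var[L; ν] = v := by
    rw [← variance_id_gaussianReal (μ := mu) (v := v), ← hmap, variance_map (by fun_prop)
      (by fun_prop)]
    rfl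
  rw [hmap, hid, hvar, Real.toNNReal_coe]

lemma measurable_mulVec_comp {d : ℕ} {m : MeasurableSpace Ω} {f : Ω → (Fin d → ℝ)}
    (M : Matrix (Fin d) (Fin d) ℝ) (hf : Measurable f) : Measurable fun ω => M *ᵥ f ω :=
  (Continuous.matrix_mulVec continuous_const continuous_id).measurable.comp hf

lemma comap_le_sigmaOf [MeasurableSpace Ω] {d : ℕ} (x : ℕ → Ω → (Fin d → ℝ)) {S : Set ℕ} {k : ℕ}
    (hk : k ∈ S) : MeasurableSpace.comap (x k) inferInstance ≤ sigmaOf x S :=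
  le_iSup₂_of_le k hk le_rfl

lemma measurable_sigmaOf [MeasurableSpace Ω] {d : ℕ} (x : ℕ → Ω → (Fin d → ℝ)) {S : Set ℕ} {k : ℕ}
    (hk : k ∈ S) : Measurable[sigmaOf x S] (x k) :=
  measurable_iff_comap_le.2 (comap_le_sigmaOf x hk)

/-- The σ-fields generated by disjoint blocks of jointly Gaussian white noise are independent. -/
lemma indep_sigmaOf_of_white [MeasurableSpace Ω] {d N : ℕ} {P : Measure Ω}
    [IsProbabilityMeasure P] {e : ℕ → Ω → (Fin d → ℝ)} (he : ∀ k ≤ N, Measurable (e k))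
    (hG : IsGaussianVec (stacked N e) P) (h0 : ∀ k ≤ N, ∀ a, ∫ ω, e k ω a ∂P = 0)
    (hw : ∀ k ≤ N, ∀ j ≤ N, k ≠ j → ∀ a b, ∫ ω, e k ω a * e j ω b ∂P = 0)
    {S T : Set ℕ} (hS : ∀ k ∈ S, k ≤ N) (hT : ∀ k ∈ T, k ≤ N) (hST : Disjoint S T) :
    Indep (sigmaOf e S) (sigmaOf e T) P := by
  have hm : Measurable (stacked N e) :=
    measurable_pi_lambda _ fun p =>
      (measurable_pi_apply p.2).comp (he p.1 (Nat.lt_succ_iff.1 p.1.2))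
  have hlaw := hG.hasGaussianLaw hm
  let L : (Fin (N + 1) × Fin d → ℝ) →L[ℝ] (Fin (N + 1) → Fin d → ℝ) :=
    ContinuousLinearMap.pi fun i => ContinuousLinearMap.pi fun a =>
      ContinuousLinearMap.proj (i, a)
  have hlaw' : HasGaussianLaw (fun ω (i : Fin (N + 1)) (a : Fin d) => e i ω a) P :=
    hlaw.map L
  have hLp : ∀ i : Fin (N + 1), ∀ a, MemLp (fun ω => e i ω a) 2 P := fun i a =>
    (hlaw.eval (i, a)).memLp_two
  have hi := HasGaussianLaw.iIndepFun_of_covariance_eval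
    (X := fun (i : Fin (N + 1)) (a : Fin d) ω => e i ω a) hlaw' (by
      intro i j hij a b
      rw [covariance_eq_sub (hLp i a) (hLp j b)]
      have := hw i (by omega) j (by omega) (fun h => hij (Fin.ext h)) a b
      simp only [Pi.mul_apply, this, h0 i (by omega) a, zero_mul, sub_zero])
  have hd := indep_iSup_of_disjoint
    (fun i : Fin (N + 1) => (he i (Nat.lt_succ_iff.1 i.2)).comap_le) hi.iIndep
    (hST.preimage (Fin.val : Fin (N + 1) → ℕ))
  have hle : ∀ U : Set ℕ, (∀ k ∈ U, k ≤ N) → sigmaOf e U ≤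
      ⨆ i ∈ ((Fin.val : Fin (N + 1) → ℕ) ⁻¹' U), MeasurableSpace.comap (e i) inferInstance :=
    fun U hU => iSup₂_le fun k hk =>
      le_iSup₂_of_le (f := fun (i : Fin (N + 1)) (_ : i ∈ (Fin.val ⁻¹' U : Set (Fin (N + 1)))) =>
        MeasurableSpace.comap (e i) inferInstance)
        (⟨k, Nat.lt_succ_iff.2 (hU k hk)⟩ : Fin (N + 1)) hk le_rfl
  exact indep_of_indep_of_le_left (indep_of_indep_of_le_right hd (hle T hT)) (hle S hS)

/-- any zero-mean Gaussian sequence governed by a `CM_c` model is a `CM_c`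
sequence. -/
theorem stmt_8 [MeasurableSpace Ω] [StandardBorelSpace Ω]
    (N d c : ℕ) (hN : 2 ≤ N) (hd : 1 ≤ d) (hc : c = 0 ∨ c = N)
    (P : Measure Ω) [IsProbabilityMeasure P]
    (x : ℕ → Ω → (Fin d → ℝ)) (hx : ∀ k, Measurable (x k))
    (e : ℕ → Ω → (Fin d → ℝ))
    (A B : ℕ → Matrix (Fin d) (Fin d) ℝ) (G0N : Matrix (Fin d) (Fin d) ℝ)
    (G : ℕ → Matrix (Fin d) (Fin d) ℝ)
    (hxG : IsGaussianVec (stacked N x) P)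
    (hx0 : ∀ k ≤ N, ∀ a, ∫ ω, x k ω a ∂P = 0)
    (h : GovernedBy N c P x A B G0N e G) :
    IsCM N c P x hx := by
  obtain ⟨hJ, h0, hw, -, hdyn, hc0, hcN⟩ := h
  have hcle : c ≤ N := by omega
  have hxc : x c = e c := by
    rcases hc with rfl | rfl
    · exact hc0 rfl
    · exact (hcN rfl).1
  have he : ∀ k ≤ N, Measurable (e k) := by
    intro k hk
    by_cases hkc : k = c
    · rw [hkc, ← hxc]; exact hx c
    rcases Nat.eq_zero_or_pos k with rfl | hk0
    · have hcN' : c = N := by omega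
      have : e 0 = fun ω => x 0 ω - G0N *ᵥ x N ω := by
        funext ω; rw [(hcN hcN').2 ω]; simp
      rw [this]
      exact (hx 0).sub (measurable_mulVec_comp _ (hx N))
    · have : e k = fun ω => x k ω - (A k *ᵥ x (k - 1) ω + B k *ᵥ x c ω) := by
        funext ω; rw [hdyn k hk0 hk hkc ω]; simp
      rw [this]
      exact (hx k).sub
        ((measurable_mulVec_comp _ (hx _)).add (measurable_mulVec_comp _ (hx _)))
  have hG : IsGaussianVec (stacked N e) P := by
    intro a
    obtain ⟨mu, v, hv⟩ := hJ (Sum.elim 0 a)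
    refine ⟨mu, v, ?_⟩
    rw [← hv]
    congr 1
    funext ω
    simp [Fintype.sum_sum_type]
  have hstep : ∀ (m : MeasurableSpace Ω) (k : ℕ), 1 ≤ k → k ≤ N → k ≠ c →
      Measurable[m] (x (k - 1)) → Measurable[m] (x c) → Measurable[m] (e k) →
      Measurable[m] (x k) := by
    intro m k hk1 hk hkc h1 h2 h3
    rw [show x k = fun ω => A k *ᵥ x (k - 1) ω + B k *ᵥ x c ω + e k ω from
      funext (hdyn k hk1 hk hkc)]
    exact ((measurable_mulVec_comp _ h1).add (measurable_mulVec_comp _ h2)).add h3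
  intro j hj
  let past : Set ℕ := {k | k ≤ N ∧ (k ≤ j ∨ k = c)}
  let fut : Set ℕ := {k | j < k ∧ k ≤ N ∧ k ≠ c}
  have hleE : ∀ U : Set ℕ, (∀ k ∈ U, k ≤ N) → sigmaOf e U ≤ ‹MeasurableSpace Ω› :=
    fun U hU => iSup₂_le fun k hk => (he k (hU k hk)).comap_le
  have hind : Indep (sigmaOf e fut) (sigmaOf e past) P := by
    refine indep_sigmaOf_of_white he hG h0 hw (fun k hk => hk.2.1) (fun k hk => hk.1) ?_
    refine Set.disjoint_left.2 fun k hk hk' => ?_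
    rcases hk'.2 with h | h
    · exact absurd hk.1 (not_lt.2 h)
    · exact hk.2.2 h
  have hxc_past : Measurable[sigmaOf e past] (x c) := by
    rw [hxc]; exact measurable_sigmaOf e ⟨hcle, Or.inr rfl⟩
  have hx_past : ∀ k ≤ j, Measurable[sigmaOf e past] (x k) := by
    intro k
    induction k with
    | zero =>
      intro _
      have he0 : Measurable[sigmaOf e past] (e 0) :=
        measurable_sigmaOf e ⟨Nat.zero_le _, Or.inl (Nat.zero_le _)⟩
      rcases hc with rfl | rfl
      · exact hxc_past
      · rw [show x 0 = fun ω => G0N *ᵥ x c ω + e 0 ω from funext (hcN rfl).2]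
        exact (measurable_mulVec_comp _ hxc_past).add he0
    | succ k ih =>
      intro hk
      by_cases hkc : k + 1 = c
      · rw [hkc]; exact hxc_past
      exact hstep _ (k + 1) (by omega) (by omega) hkc (ih (by omega)) hxc_past
        (measurable_sigmaOf e ⟨by omega, Or.inl hk⟩)
  have hcond_past : sigmaOf x {j, c} ≤ sigmaOf e past := by
    refine iSup₂_le fun k hk => ?_
    rcases hk with rfl | rfl
    · exact (hx_past _ le_rfl).comap_le
    · exact hxc_past.comap_le
  have hpast : sigmaOf x {k | k < j ∧ k ≠ c} ≤ sigmaOf e past :=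
    iSup₂_le fun k hk => (hx_past k hk.1.le).comap_le
  have hx_fut : ∀ k, j ≤ k → k ≤ N →
      Measurable[sigmaOf x {j, c} ⊔ sigmaOf e fut] (x k) := by
    have hxc' : Measurable[sigmaOf x {j, c} ⊔ sigmaOf e fut] (x c) :=
      (measurable_sigmaOf x (Or.inr rfl : c ∈ ({j, c} : Set ℕ))).mono le_sup_left le_rfl
    intro k hjk
    induction k, hjk using Nat.le_induction with
    | base =>
      exact fun _ =>
        (measurable_sigmaOf x (Or.inl rfl : j ∈ ({j, c} : Set ℕ))).mono le_sup_left le_rfl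
    | succ k hjk ih =>
      intro hk
      by_cases hkc : k + 1 = c
      · rw [hkc]; exact hxc'
      refine hstep _ (k + 1) (by omega) hk hkc (ih (by omega)) hxc' ?_
      exact (measurable_sigmaOf e (⟨by omega, hk, hkc⟩ : k + 1 ∈ fut)).mono le_sup_right le_rfl
  have hfut : sigmaOf x {k | j < k ∧ k ≤ N ∧ k ≠ c} ≤ sigmaOf x {j, c} ⊔ sigmaOf e fut :=
    iSup₂_le fun k hk => (hx_fut k hk.1.le hk.2.1).comap_le
  have hci := condIndep_sup_of_indep (sigmaOf_le hx {j, c}) (hleE fut fun k hk => hk.2.1)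
    (hleE past fun k hk => hk.1) hcond_past P hind
  exact condIndep_of_condIndep_of_le_left (condIndep_of_condIndep_of_le_right hci hpast) hfut
end

section
/- Fix c ∈ {0, N}. A ZMNG sequence [x_k] is CM_c if and only if it is governed by some CM_c model, i.e., if and only if there exist d×d matrices G_{k,k−1}, G_{k,c} for k ∈ [1,N] \ {c} (and G_{0,N} if c = N) and a zero-mean white Gaussian sequence [e_k]_{k=0}^N with positive definite covariances G_k such that x_k = G_{k,k−1} x_{k−1} + G_{k,c} x_c + e_k for k ∈ [1,N] \ {c}, with x_0 = e_0 when c = 0, and x_N = e_N and x_0 = G_{0,N} x_N + e_0 when c = N. -/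
open MeasureTheory ProbabilityTheory

variable {Ω : Type*}

/-- Zero-mean nonsingular Gaussian (ZMNG) sequence: the stacked vector is Gaussian with
zero mean and positive definite covariance matrix. -/
def IsZMNG {d : ℕ} (N : ℕ) [MeasurableSpace Ω] (P : Measure Ω)
    (x : ℕ → Ω → (Fin d → ℝ)) : Prop :=
  IsGaussianVec (stacked N x) P ∧
  (∀ k ≤ N, ∀ a, ∫ ω, x k ω a ∂P = 0) ∧
  (Matrix.of fun p q : Fin (N + 1) × Fin d =>
    ∫ ω, x p.1 ω p.2 * x q.1 ω q.2 ∂P).PosDef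

/-- The σ-algebra generated by a set of real-valued functions. -/
abbrev sigmaSet (S : Set (Ω → ℝ)) : MeasurableSpace Ω :=
  ⨆ f ∈ S, MeasurableSpace.comap f inferInstance

lemma sigmaSet_le {m : MeasurableSpace Ω} {S : Set (Ω → ℝ)} (h : ∀ f ∈ S, Measurable[m] f) :
    sigmaSet S ≤ m :=
  iSup₂_le fun f hf => (h f hf).comap_le

lemma measurable_sigmaSet {S : Set (Ω → ℝ)} {f : Ω → ℝ} (hf : f ∈ S) :
    Measurable[sigmaSet S] f :=
  Measurable.of_comap_le (le_iSup₂_of_le f hf le_rfl)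

lemma measurable_of_mem_span {m : MeasurableSpace Ω} {S : Set (Ω → ℝ)} {f : Ω → ℝ}
    (h : ∀ g ∈ S, Measurable[m] g) (hf : f ∈ Submodule.span ℝ S) : Measurable[m] f := by
  induction hf using Submodule.span_induction with
  | mem g hg => exact h g hg
  | zero => exact measurable_zero
  | add g g' _ _ hg hg' => exact hg.add hg'
  | smul c g _ hg => exact hg.const_smul c

lemma sigmaSet_union (S T : Set (Ω → ℝ)) : sigmaSet (S ∪ T) = sigmaSet S ⊔ sigmaSet T :=
  iSup_union

lemma sigmaSet_le_of_subset_span {S T : Set (Ω → ℝ)} (h : S ⊆ Submodule.span ℝ T) :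
    sigmaSet S ≤ sigmaSet T :=
  sigmaSet_le fun _ hf => measurable_of_mem_span (fun _ hg => measurable_sigmaSet hg) (h hf)

lemma sigmaSet_range {ι : Type*} (X : ι → Ω → ℝ) :
    sigmaSet (Set.range X) = MeasurableSpace.comap (fun ω i => X i ω) inferInstance := by
  simp only [sigmaSet, iSup_range, MeasurableSpace.pi, MeasurableSpace.comap_iSup,
    MeasurableSpace.comap_comp]
  rfl

/-- If `m₃` is independent of `m ⊔ m₂`, then `m ⊔ m₃` and `m₂` are conditionally independent
given `m`. -/
lemma condIndep_sup_of_indep_s9 {m m₂ m₃ mΩ : MeasurableSpace Ω} [StandardBorelSpace Ω]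
    {P : Measure Ω} [IsFiniteMeasure P] (hm : m ≤ mΩ) (h₂ : m₂ ≤ mΩ) (h₃ : m₃ ≤ mΩ)
    (hind : Indep m₃ (m ⊔ m₂) P) : CondIndep m (m ⊔ m₃) m₂ hm P := by
  have key : ∀ A B C, MeasurableSet[m] A → MeasurableSet[m₃] B → MeasurableSet[m₂] C →
      P⟦A ∩ B ∩ C|m⟧ =ᵐ[P] fun ω => A.indicator 1 ω * (P.real B * (P⟦C|m⟧) ω) := by
    intro A B C hA hB hC
    have hA' := hm _ hA
    have hB' := h₃ _ hB
    have hC' := h₂ _ hC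
    have hle : m ⊔ m₂ ≤ mΩ := sup_le hm h₂
    have hAC : MeasurableSet[m ⊔ m₂] (A ∩ C) :=
      (le_sup_left (b := m₂) _ hA).inter (le_sup_right (a := m) _ hC)
    have h1 : P⟦A ∩ B ∩ C|m ⊔ m₂⟧ =ᵐ[P] fun ω => P.real B * (A ∩ C).indicator 1 ω := by
      have e : (A ∩ B ∩ C).indicator (fun _ => (1 : ℝ))
          = (A ∩ C).indicator (B.indicator fun _ => (1 : ℝ)) := by
        rw [Set.indicator_indicator]; congr 1; ext; simp; tauto
      rw [e]
      have h2 := condExp_indicator (μ := P) (m := m ⊔ m₂)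
        (f := B.indicator fun _ => (1 : ℝ)) ((integrable_const 1).indicator hB') hAC
      have h3 := condExp_indep_eq (μ := P) h₃ hle
        (f := B.indicator fun _ => (1 : ℝ)) (stronglyMeasurable_const.indicator hB) hind
      filter_upwards [h2, h3] with ω h2 h3
      rw [h2]
      by_cases hω : ω ∈ A ∩ C
      · simp only [hω, Set.indicator_of_mem, h3, Pi.one_apply, mul_one]
        exact integral_indicator_one hB'
      · simp [hω]
    have h4 : P⟦A ∩ B ∩ C|m⟧ =ᵐ[P] P[fun ω => P.real B * (A ∩ C).indicator 1 ω | m] :=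
      (condExp_condExp_of_le le_sup_left hle).symm.trans (condExp_congr_ae h1)
    have e : (fun ω => P.real B * (A ∩ C).indicator 1 ω)
        = A.indicator (P.real B • C.indicator fun _ => (1 : ℝ)) := by
      ext ω
      by_cases h : ω ∈ A <;> by_cases h' : ω ∈ C <;> simp [h, h']
    rw [e] at h4
    have hiC : Integrable (C.indicator fun _ => (1 : ℝ)) P := (integrable_const 1).indicator hC'
    filter_upwards [h4, condExp_indicator (μ := P) (hiC.smul (P.real B)) hA,
      condExp_smul (μ := P) (P.real B) (C.indicator fun _ => (1 : ℝ)) m] with ω h4 h5 h6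
    rw [h4, h5]
    by_cases h : ω ∈ A <;> simp [h, h6]
  let p : Set (Set Ω) := Set.image2 (· ∩ ·) {A | MeasurableSet[m] A} {B | MeasurableSet[m₃] B}
  have hp : IsPiSystem p := by
    rintro _ ⟨A, hA, B, hB, rfl⟩ _ ⟨A', hA', B', hB', rfl⟩ _
    exact ⟨A ∩ A', MeasurableSet.inter hA hA', B ∩ B', MeasurableSet.inter hB hB',
      Set.inter_inter_inter_comm _ _ _ _⟩
  have hgen : m ⊔ m₃ = MeasurableSpace.generateFrom p := by
    apply le_antisymm
    · refine sup_le (fun A hA => ?_) fun B hB => ?_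
      · exact MeasurableSpace.measurableSet_generateFrom ⟨A, hA, Set.univ, .univ, by simp⟩
      · exact MeasurableSpace.measurableSet_generateFrom ⟨Set.univ, .univ, B, hB, by simp⟩
    · refine MeasurableSpace.generateFrom_le ?_
      rintro _ ⟨A, hA, B, hB, rfl⟩
      exact (le_sup_left (b := m₃) _ hA).inter (le_sup_right (a := m) _ hB)
  refine CondIndepSets.condIndep (sup_le hm h₃) h₂ hp (@MeasurableSpace.isPiSystem_measurableSet _ m₂)
    hgen (@MeasurableSpace.generateFrom_measurableSet _ m₂).symm ?_
  refine (condIndepSets_iff m hm p _ ?_ (fun C hC => h₂ _ hC) P).2 ?_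
  · rintro _ ⟨A, hA, B, hB, rfl⟩
    exact (hm _ hA).inter (h₃ _ hB)
  · rintro _ C ⟨A, hA, B, hB, rfl⟩ hC
    have h1 := key A B Set.univ hA hB .univ
    rw [Set.inter_univ] at h1
    filter_upwards [h1, key A B C hA hB hC] with ω h1 h2
    rw [Pi.mul_apply, h1, h2]
    simp [mul_assoc, condExp_const hm]

/-- Conditional expectations of products of conditionally independent functions factor. -/
lemma condExp_mul_of_condIndepFun {m mΩ : MeasurableSpace Ω} [StandardBorelSpace Ω]
    {P : Measure Ω} [IsFiniteMeasure P] {hm : m ≤ mΩ} {f g : Ω → ℝ}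
    (hf : Measurable f) (hg : Measurable g) (hif : Integrable f P) (hig : Integrable g P)
    (hfg : Integrable (f * g) P) (h : CondIndepFun m hm f g P) :
    P[f * g | m] =ᵐ[P] P[f | m] * P[g | m] := by
  rw [condIndepFun_iff_map_prod_eq_prod_map_map hf hg] at h
  filter_upwards [ae_of_ae_trim hm h, condExp_ae_eq_integral_condExpKernel hm hif,
    condExp_ae_eq_integral_condExpKernel hm hig,
    condExp_ae_eq_integral_condExpKernel hm hfg] with ω h h1 h2 h3
  rw [Pi.mul_apply, h1, h2, h3]
  rw [Kernel.prod_apply, Kernel.map_apply _ hf, Kernel.map_apply _ hg,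
    Kernel.map_apply _ (hf.prodMk hg)] at h
  exact IndepFun.integral_mul_eq_mul_integral
    ((indepFun_iff_map_prod_eq_prod_map_map hf.aemeasurable hg.aemeasurable).2 h)
    hf.aestronglyMeasurable hg.aestronglyMeasurable

/-- If `f` and `g` are conditionally independent given `m`, and `f - p` is independent of `m` and
centered for some `m`-measurable `p`, then `f - p` and `g` are uncorrelated. -/
lemma integral_sub_mul_eq_zero_of_condIndepFun {m mΩ : MeasurableSpace Ω} [StandardBorelSpace Ω]
    {P : Measure Ω} [IsFiniteMeasure P] {hm : m ≤ mΩ} {f g p : Ω → ℝ}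
    (hf : Measurable f) (hg : Measurable g) (hf2 : MemLp f 2 P) (hg2 : MemLp g 2 P)
    (hp2 : MemLp p 2 P) (hp : Measurable[m] p) (h0 : ∫ ω, (f ω - p ω) ∂P = 0)
    (hind : Indep (MeasurableSpace.comap (f - p) inferInstance) m P)
    (h : CondIndepFun m hm f g P) : ∫ ω, (f ω - p ω) * g ω ∂P = 0 := by
  have hif := hf2.integrable one_le_two
  have hig := hg2.integrable one_le_two
  have hip := hp2.integrable one_le_two
  have hfg : Integrable (f * g) P := hf2.integrable_mul hg2
  have hpg : Integrable (p * g) P := hp2.integrable_mul hg2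
  have hps : StronglyMeasurable[m] p := hp.stronglyMeasurable
  have hfp : P[f | m] =ᵐ[P] p := by
    have h1 : P[f - p | m] =ᵐ[P] fun _ => 0 := by
      refine (condExp_indep_eq (hf.sub (hp.mono hm le_rfl)).comap_le hm
        (Measurable.stronglyMeasurable (comap_measurable _)) hind).trans ?_
      rw [← h0]; rfl
    have h2 := condExp_sub hif hip m
    rw [condExp_of_stronglyMeasurable hm hps hip] at h2
    filter_upwards [h1, h2] with ω h1 h2
    rw [h1, Pi.sub_apply] at h2
    linarith
  have h1 : P[f * g | m] =ᵐ[P] P[p * g | m] :=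
    (condExp_mul_of_condIndepFun hf hg hif hig hfg h).trans
      ((hfp.mul .rfl).trans (condExp_mul_of_stronglyMeasurable_left hps hpg hig).symm)
  have h2 : ∫ ω, (f * g) ω ∂P = ∫ ω, (p * g) ω ∂P := by
    rw [← integral_condExp hm, integral_congr_ae h1, integral_condExp hm]
  simp_rw [sub_mul]
  exact (integral_sub hfg hpg).trans (sub_eq_zero.2 h2)

/-- A linear space of measurable centered random variables that are jointly Gaussian. -/
structure IsCenteredGaussianSpace [MeasurableSpace Ω] (W : Submodule ℝ (Ω → ℝ)) (P : Measure Ω) :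
    Prop where
  measurable : ∀ f ∈ W, Measurable f
  integral_eq_zero : ∀ f ∈ W, ∫ ω, f ω ∂P = 0
  isGaussianProcess : IsGaussianProcess (fun f : W => (f : Ω → ℝ)) P

/-- The span of a finite centered Gaussian family is a centered Gaussian space. -/
lemma isCenteredGaussianSpace_span_range [MeasurableSpace Ω] {P : Measure Ω} {ι : Type*} [Finite ι]
    {X : ι → Ω → ℝ} (hX : ∀ i, Measurable (X i)) (h0 : ∀ i, ∫ ω, X i ω ∂P = 0)
    (hG : HasGaussianLaw (fun ω i => X i ω) P) :
    IsCenteredGaussianSpace (Submodule.span ℝ (Set.range X)) P := by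
  have := Fintype.ofFinite ι
  have hint : ∀ i, Integrable (X i) P := fun i => (hG.eval i).integrable
  refine ⟨fun f hf => measurable_of_mem_span (by rintro _ ⟨i, rfl⟩; exact hX i) hf,
    fun f hf => ?_, ⟨fun I => ?_⟩⟩
  · obtain ⟨c, rfl⟩ := (Submodule.mem_span_range_iff_exists_fun ℝ).1 hf
    simp only [Finset.sum_apply, Pi.smul_apply, smul_eq_mul]
    rw [integral_finsetSum _ fun i _ => (hint i).const_mul _]
    simp [integral_const_mul, h0]
  · have h : ∀ f : Submodule.span ℝ (Set.range X), ∃ c : ι → ℝ, ∑ i, c i • X i = f :=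
      fun f => (Submodule.mem_span_range_iff_exists_fun ℝ).1 f.2
    choose c hc using h
    let L : (ι → ℝ) →L[ℝ] (I → ℝ) :=
      ContinuousLinearMap.pi fun f => ∑ i, c f i • ContinuousLinearMap.proj i
    have hL : (fun ω => I.restrict fun f : Submodule.span ℝ (Set.range X) => (f : Ω → ℝ) ω)
        = fun ω => L fun i => X i ω := by
      ext ω f
      simp [L, ← hc]
    exact hL ▸ hG.map_fun L

namespace IsCenteredGaussianSpace

variable [MeasurableSpace Ω] {W : Submodule ℝ (Ω → ℝ)} {P : Measure Ω}

lemma hasGaussianLaw (hW : IsCenteredGaussianSpace W P) {f : Ω → ℝ} (hf : f ∈ W) :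
    HasGaussianLaw f P :=
  hW.isGaussianProcess.hasGaussianLaw_eval ⟨f, hf⟩

lemma memLp_two (hW : IsCenteredGaussianSpace W P) {f : Ω → ℝ} (hf : f ∈ W) : MemLp f 2 P :=
  (hW.hasGaussianLaw hf).memLp_two

lemma integrable_mul (hW : IsCenteredGaussianSpace W P) {f g : Ω → ℝ} (hf : f ∈ W) (hg : g ∈ W) :
    Integrable (fun ω => f ω * g ω) P :=
  (hW.memLp_two hf).integrable_mul (hW.memLp_two hg)

lemma integral_mul_eq_zero_of_mem_span (hW : IsCenteredGaussianSpace W P) {S : Set (Ω → ℝ)}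
    (hS : S ⊆ W) {f g : Ω → ℝ} (hf : f ∈ W) (h : ∀ g ∈ S, ∫ ω, f ω * g ω ∂P = 0)
    (hg : g ∈ Submodule.span ℝ S) : ∫ ω, f ω * g ω ∂P = 0 := by
  have hSW : Submodule.span ℝ S ≤ W := Submodule.span_le.2 hS
  induction hg using Submodule.span_induction with
  | mem g hg => exact h g hg
  | zero => simp
  | add g g' hg hg' h1 h2 =>
    simp only [Pi.add_apply, mul_add]
    rw [integral_add (hW.integrable_mul hf (hSW hg)) (hW.integrable_mul hf (hSW hg')), h1, h2,
      add_zero]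
  | smul c g _ h1 =>
    simp only [Pi.smul_apply, smul_eq_mul, mul_left_comm _ c]
    rw [integral_const_mul, h1, mul_zero]

/-- In a centered Gaussian space, uncorrelated families are independent. -/
lemma indep (hW : IsCenteredGaussianSpace W P) {U V : Set (Ω → ℝ)} (hU : U ⊆ W) (hV : V ⊆ W)
    (h : ∀ u ∈ U, ∀ v ∈ V, ∫ ω, u ω * v ω ∂P = 0) : Indep (sigmaSet U) (sigmaSet V) P := by
  have := hW.isGaussianProcess.isProbabilityMeasure
  have hG : IsGaussianProcess (Sum.elim (fun u : U => (u : Ω → ℝ)) fun v : V => (v : Ω → ℝ)) P := by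
    have hc : Sum.elim (fun u : U => (u : Ω → ℝ)) (fun v : V => (v : Ω → ℝ))
        = (fun f : W => (f : Ω → ℝ)) ∘
          Sum.elim (fun u : U => (⟨u, hU u.2⟩ : W)) fun v : V => (⟨v, hV v.2⟩ : W) := by
      ext (i | i) <;> rfl
    exact hc ▸ hW.isGaussianProcess.comp_right _
  have hind := hG.indepFun_of_covariance_eq_zero
    (fun u => (hW.measurable _ (hU u.2)).aemeasurable)
    (fun v => (hW.measurable _ (hV v.2)).aemeasurable) fun u v => by
      rw [covariance_eq_sub (hW.memLp_two (hU u.2)) (hW.memLp_two (hV v.2)),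
        hW.integral_eq_zero _ (hU u.2), zero_mul, sub_zero]
      exact h u u.2 v v.2
  rw [IndepFun_iff_Indep, ← sigmaSet_range, ← sigmaSet_range, Subtype.range_coe,
    Subtype.range_coe] at hind
  exact hind

lemma condIndep_of_integral_mul_eq_zero [StandardBorelSpace Ω] [IsFiniteMeasure P]
    (hW : IsCenteredGaussianSpace W P)
    {M F T E : Set (Ω → ℝ)} (hM : M ⊆ W) (hT : T ⊆ W) (hE : E ⊆ W)
    (hF : F ⊆ Submodule.span ℝ (M ∪ E)) (h : ∀ f ∈ E, ∀ g ∈ M ∪ T, ∫ ω, f ω * g ω ∂P = 0)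
    (hm : sigmaSet M ≤ ‹MeasurableSpace Ω›) :
    CondIndep (sigmaSet M) (sigmaSet F) (sigmaSet T) hm P := by
  have hind := hW.indep hE (Set.union_subset hM hT) h
  rw [sigmaSet_union] at hind
  refine condIndep_of_condIndep_of_le_left
    (condIndep_sup_of_indep_s9 hm (sigmaSet_le fun f hf => hW.measurable f (hT hf))
      (sigmaSet_le fun f hf => hW.measurable f (hE hf)) hind) ?_
  rw [← sigmaSet_union]
  exact sigmaSet_le_of_subset_span hF

lemma integral_mul_eq_zero_of_condIndep [StandardBorelSpace Ω] [IsFiniteMeasure P]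
    (hW : IsCenteredGaussianSpace W P)
    {M F T : Set (Ω → ℝ)} (hM : M ⊆ W) (hF : F ⊆ W) (hT : T ⊆ W)
    {hm : sigmaSet M ≤ ‹MeasurableSpace Ω›}
    (hci : CondIndep (sigmaSet M) (sigmaSet F) (sigmaSet T) hm P)
    {f g p : Ω → ℝ} (hf : f ∈ F) (hg : g ∈ T) (hp : p ∈ Submodule.span ℝ M)
    (h : ∀ q ∈ M, ∫ ω, (f ω - p ω) * q ω ∂P = 0) : ∫ ω, (f ω - p ω) * g ω ∂P = 0 := by
  have hpW : p ∈ W := Submodule.span_le.2 hM hp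
  have hfp : f - p ∈ W := W.sub_mem (hF hf) hpW
  refine integral_sub_mul_eq_zero_of_condIndepFun (hm := hm) (hW.measurable _ (hF hf))
    (hW.measurable _ (hT hg)) (hW.memLp_two (hF hf)) (hW.memLp_two (hT hg)) (hW.memLp_two hpW)
    (measurable_of_mem_span (fun _ hq => measurable_sigmaSet hq) hp)
    (hW.integral_eq_zero _ hfp) ?_ ?_
  · have := hW.indep (U := {f - p}) (V := M) (by simpa using hfp) hM (by simpa using h)
    simpa [sigmaSet] using this
  · rw [condIndepFun_iff_condIndep]
    exact condIndep_of_condIndep_of_le_right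
      (condIndep_of_condIndep_of_le_left hci (measurable_sigmaSet hf).comap_le)
      (measurable_sigmaSet hg).comap_le

/-- Existence of the best linear predictor of `f` from the finite family `Y`. -/
lemma exists_projection (hW : IsCenteredGaussianSpace W P) {ι : Type*} [Fintype ι]
    {Y : ι → Ω → ℝ} (hY : ∀ i, Y i ∈ W) {f : Ω → ℝ} (hf : f ∈ W) :
    ∃ c : ι → ℝ, ∀ i, ∫ ω, (f ω - ∑ j, c j * Y j ω) * Y i ω ∂P = 0 := by
  let Φ : W →ₗ[ℝ] Lp ℝ 2 P :=
    { toFun := fun w => (hW.memLp_two w.2).toLp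
      map_add' := fun _ _ => rfl
      map_smul' := fun _ _ => rfl }
  have hΦ : ∀ w : W, Φ w =ᵐ[P] (w : Ω → ℝ) := fun w => (hW.memLp_two w.2).coeFn_toLp
  let y : ι → W := fun i => ⟨Y i, hY i⟩
  let z : W := ⟨f, hf⟩
  let T : Submodule ℝ (Lp ℝ 2 P) := Submodule.span ℝ (Set.range fun i => Φ (y i))
  have : FiniteDimensional ℝ T := FiniteDimensional.span_of_finite ℝ (Set.finite_range _)
  obtain ⟨c, hc⟩ := (Submodule.mem_span_range_iff_exists_fun ℝ).1
    (T.starProjection_apply_mem (Φ z))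
  refine ⟨c, fun i => ?_⟩
  have h := T.starProjection_inner_eq_zero (Φ z) (Φ (y i)) (Submodule.subset_span ⟨i, rfl⟩)
  have hsum : Φ z - T.starProjection (Φ z) = Φ (z - ∑ j, c j • y j) := by
    rw [← hc]
    simp
  rw [hsum, L2.inner_def] at h
  rw [← h]
  refine integral_congr_ae ?_
  filter_upwards [hΦ (z - ∑ j, c j • y j), hΦ (y i)] with ω h1 h2
  rw [h1, h2]
  simp [y, z, mul_comm]

end IsCenteredGaussianSpace

/-- The coordinate random variables of `x k`, `k ∈ K`. -/
def coords {d : ℕ} (x : ℕ → Ω → (Fin d → ℝ)) (K : Set ℕ) : Set (Ω → ℝ) :=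
  {f | ∃ k ∈ K, ∃ a, f = fun ω => x k ω a}

section coords

variable {d : ℕ} {x : ℕ → Ω → (Fin d → ℝ)}

lemma mem_coords {K : Set ℕ} {k : ℕ} (hk : k ∈ K) (a : Fin d) :
    (fun ω => x k ω a) ∈ coords x K :=
  ⟨k, hk, a, rfl⟩

lemma coords_mono {K L : Set ℕ} (h : K ⊆ L) : coords x K ⊆ coords x L := by
  rintro _ ⟨k, hk, a, rfl⟩
  exact mem_coords (h hk) a

lemma sigmaOf_eq_sigmaSet [MeasurableSpace Ω] (K : Set ℕ) :
    sigmaOf x K = sigmaSet (coords x K) := by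
  have hk : ∀ k, MeasurableSpace.comap (x k) inferInstance
      = sigmaSet (Set.range fun a ω => x k ω a) := fun k => (sigmaSet_range _).symm
  apply le_antisymm
  · refine iSup₂_le fun k hk' => ?_
    rw [hk]
    refine iSup₂_le ?_
    rintro _ ⟨a, rfl⟩
    exact (measurable_sigmaSet (mem_coords hk' a)).comap_le
  · refine iSup₂_le ?_
    rintro _ ⟨k, hk', a, rfl⟩
    refine le_iSup₂_of_le k hk' ?_
    rw [hk]
    exact (measurable_sigmaSet (S := Set.range fun a ω => x k ω a) (Set.mem_range_self a)).comap_le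

lemma mulVec_mem {V : Submodule ℝ (Ω → ℝ)} {y : Ω → (Fin d → ℝ)}
    (hy : ∀ a, (fun ω => y ω a) ∈ V) (A : Matrix (Fin d) (Fin d) ℝ) (a : Fin d) :
    (fun ω => A.mulVec (y ω) a) ∈ V := by
  have : (fun ω => A.mulVec (y ω) a) = ∑ b, A a b • fun ω => y ω b := by
    ext ω
    simp [Matrix.mulVec, dotProduct]
  exact this ▸ V.sum_mem fun b _ => V.smul_mem _ (hy b)

lemma coords_subset_span {K L : Set ℕ} (h : K ⊆ L) :
    coords x K ⊆ Submodule.span ℝ (coords x L) :=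
  (coords_mono h).trans Submodule.subset_span

lemma coords_mem_span {K : Set ℕ} {k : ℕ} (hk : k ∈ K) (a : Fin d) :
    (fun ω => x k ω a) ∈ Submodule.span ℝ (coords x K) :=
  Submodule.subset_span (mem_coords hk a)

variable [MeasurableSpace Ω]

lemma IsZMNG.isCenteredGaussianSpace {P : Measure Ω} {N : ℕ} (h : IsZMNG N P x)
    (hx : ∀ k, Measurable (x k)) :
    IsCenteredGaussianSpace (Submodule.span ℝ (coords x {k | k ≤ N})) P := by
  have hr : coords x {k | k ≤ N}
      = Set.range fun (p : Fin (N + 1) × Fin d) ω => stacked N x ω p := by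
    ext f
    constructor
    · rintro ⟨k, hk, a, rfl⟩
      exact ⟨(⟨k, Nat.lt_succ_of_le hk⟩, a), rfl⟩
    · rintro ⟨p, rfl⟩
      exact mem_coords (K := {k | k ≤ N}) (Nat.le_of_lt_succ p.1.2) p.2
  have hm : ∀ p, Measurable fun ω => stacked N x ω p := fun p =>
    (measurable_pi_apply p.2).comp (hx p.1)
  have hm' : Measurable (stacked N x) := measurable_pi_lambda _ hm
  rw [hr]
  refine isCenteredGaussianSpace_span_range hm
    (fun p => h.2.1 p.1 (Nat.le_of_lt_succ p.1.2) p.2) ⟨?_⟩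
  refine isGaussian_of_map_eq_gaussianReal fun L => ?_
  obtain ⟨mu, v, hv⟩ := h.1 fun p => L (Pi.single p 1)
  refine ⟨mu, v, ?_⟩
  rw [← hv, Measure.map_map L.continuous.measurable hm']
  congr 1
  ext ω
  simp only [Function.comp_apply]
  conv_lhs => rw [← Finset.univ_sum_single (stacked N x ω), map_sum]
  refine Finset.sum_congr rfl fun p _ => ?_
  have : Pi.single p (stacked N x ω p) = stacked N x ω p • (Pi.single p (1 : ℝ)) := by
    rw [← Pi.single_smul, smul_eq_mul, mul_one]
  rw [this, map_smul, smul_eq_mul, mul_comm]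

lemma IsCenteredGaussianSpace.dotProduct_gram {W : Submodule ℝ (Ω → ℝ)} {P : Measure Ω}
    (hW : IsCenteredGaussianSpace W P) {ι : Type*} [Fintype ι] {Y : ι → Ω → ℝ} (hY : ∀ i, Y i ∈ W)
    (w : ι → ℝ) : w ⬝ᵥ (Matrix.of fun i j => ∫ ω, Y i ω * Y j ω ∂P).mulVec w
      = ∫ ω, (∑ i, w i * Y i ω) ^ 2 ∂P := by
  have hi : ∀ i j, Integrable (fun ω => w i * (w j * (Y i ω * Y j ω))) P := fun i j =>
    ((hW.integrable_mul (hY i) (hY j)).const_mul _).const_mul _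
  have : ∀ ω, (∑ i, w i * Y i ω) ^ 2 = ∑ i, ∑ j, w i * (w j * (Y i ω * Y j ω)) := fun ω => by
    rw [sq, Finset.sum_mul_sum]
    exact Finset.sum_congr rfl fun i _ => Finset.sum_congr rfl fun j _ => by ring
  simp_rw [this]
  rw [integral_finsetSum _ fun i _ => integrable_finsetSum _ fun j _ => hi i j]
  refine Finset.sum_congr rfl fun i _ => ?_
  rw [integral_finsetSum _ fun j _ => hi i j]
  simp only [Matrix.mulVec, dotProduct, Finset.mul_sum, integral_const_mul, Matrix.of_apply]
  exact Finset.sum_congr rfl fun j _ => by ring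

/-- In a nonsingular sequence, the residual of `x k` after subtracting a linear combination of the
other variables has a positive definite covariance matrix. -/
lemma IsZMNG.posDef_residual {P : Measure Ω} {N : ℕ} (h : IsZMNG N P x)
    (hx : ∀ k, Measurable (x k)) {k : ℕ} (hk : k ≤ N) {r : Fin d → Ω → ℝ}
    (hr : ∀ a, (fun ω => x k ω a) - r a ∈ Submodule.span ℝ (coords x {l | l ≤ N ∧ l ≠ k})) :
    (Matrix.of fun a b => ∫ ω, r a ω * r b ω ∂P).PosDef := by
  have hW := h.isCenteredGaussianSpace hx
  set W := Submodule.span ℝ (coords x {k | k ≤ N})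
  have hrW : ∀ a, r a ∈ W := fun a => by
    have := W.sub_mem (Submodule.subset_span (mem_coords (K := {k | k ≤ N}) hk a))
      (Submodule.span_mono (coords_mono fun l hl => hl.1) (hr a))
    rwa [sub_sub_cancel] at this
  let k' : Fin (N + 1) := ⟨k, Nat.lt_succ_of_le hk⟩
  have hspan : ∀ q ∈ Submodule.span ℝ (coords x {l | l ≤ N ∧ l ≠ k}),
      ∃ b : Fin (N + 1) × Fin d → ℝ, (∀ a, b (k', a) = 0) ∧
        q = fun ω => ∑ p, b p * stacked N x ω p := by
    intro q hq
    induction hq using Submodule.span_induction with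
    | mem f hf =>
      obtain ⟨l, hl, a, rfl⟩ := hf
      refine ⟨Pi.single (⟨l, Nat.lt_succ_of_le hl.1⟩, a) 1, fun a' => ?_, ?_⟩
      · exact Pi.single_eq_of_ne (by simpa [k'] using fun h => absurd h.symm hl.2) _
      · ext ω
        simp [Pi.single_apply, stacked]
    | zero => exact ⟨0, by simp, by ext; simp⟩
    | add f g _ _ hf hg =>
      obtain ⟨b, hb, rfl⟩ := hf
      obtain ⟨b', hb', rfl⟩ := hg
      exact ⟨b + b', by simp [hb, hb'], by ext; simp [add_mul, Finset.sum_add_distrib]⟩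
    | smul c f _ hf =>
      obtain ⟨b, hb, rfl⟩ := hf
      exact ⟨c • b, by simp [hb], by ext; simp [Finset.mul_sum, mul_assoc]⟩
  refine Matrix.PosDef.of_dotProduct_mulVec_pos ?_ fun v hv => ?_
  · ext a b
    simp [mul_comm]
  · obtain ⟨b, hb, hbq⟩ := hspan (∑ a, v a • ((fun ω => x k ω a) - r a))
      (Submodule.sum_mem _ fun a _ => Submodule.smul_mem _ _ (hr a))
    let w : Fin (N + 1) × Fin d → ℝ := fun p => (if p.1 = k' then v p.2 else 0) - b p
    have hw : w ≠ 0 := fun h0 => hv (by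
      ext a
      simpa [w, hb] using congrFun h0 (k', a))
    have hpos := h.2.2.dotProduct_mulVec_pos hw
    rw [star_trivial] at hpos ⊢
    rw [hW.dotProduct_gram hrW]
    have hX : ∀ p : Fin (N + 1) × Fin d, (fun ω => x p.1 ω p.2) ∈ W := fun p =>
      Submodule.subset_span (mem_coords (K := {k | k ≤ N}) (Nat.le_of_lt_succ p.1.2) p.2)
    rw [hW.dotProduct_gram hX] at hpos
    convert hpos using 4 with ω
    have h1 := congrFun hbq ω
    simp only [Finset.sum_apply, Pi.smul_apply, Pi.sub_apply, smul_eq_mul, mul_sub,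
      Finset.sum_sub_distrib, stacked] at h1
    simp only [w, sub_mul, Finset.sum_sub_distrib, ← h1]
    rw [Fintype.sum_prod_type]
    simp [k', ite_mul]

/-- Linear regression of the vector `u` on the vectors `y` and `z`. -/
lemma IsCenteredGaussianSpace.exists_regression {W : Submodule ℝ (Ω → ℝ)} {P : Measure Ω}
    (hW : IsCenteredGaussianSpace W P) {u y z : Ω → (Fin d → ℝ)} (hu : ∀ a, (fun ω => u ω a) ∈ W)
    (hy : ∀ a, (fun ω => y ω a) ∈ W) (hz : ∀ a, (fun ω => z ω a) ∈ W) :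
    ∃ A B : Matrix (Fin d) (Fin d) ℝ, ∀ a b,
      ∫ ω, (u ω a - (A.mulVec (y ω) + B.mulVec (z ω)) a) * y ω b ∂P = 0 ∧
      ∫ ω, (u ω a - (A.mulVec (y ω) + B.mulVec (z ω)) a) * z ω b ∂P = 0 := by
  have h := fun a => hW.exists_projection
    (Y := Sum.elim (fun b ω => y ω b) fun b ω => z ω b) (by rintro (b | b) <;> simp [hy, hz]) (hu a)
  choose c hc using h
  refine ⟨Matrix.of fun a b => c a (.inl b), Matrix.of fun a b => c a (.inr b), fun a b =>
    ⟨?_, ?_⟩⟩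
  · simpa [Matrix.mulVec, dotProduct] using hc a (.inl b)
  · simpa [Matrix.mulVec, dotProduct] using hc a (.inr b)

end coords

section governed

variable {d N c : ℕ} {x e : ℕ → Ω → (Fin d → ℝ)} [MeasurableSpace Ω] {P : Measure Ω}

lemma condIndep_sigmaOf_iff [StandardBorelSpace Ω] [IsFiniteMeasure P] (hx : ∀ k, Measurable (x k))
    (M F T : Set ℕ) :
    CondIndep (sigmaOf x M) (sigmaOf x F) (sigmaOf x T) (sigmaOf_le hx M) P ↔
      CondIndep (sigmaSet (coords x M)) (sigmaSet (coords x F)) (sigmaSet (coords x T))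
        (sigmaOf_eq_sigmaSet (x := x) M ▸ sigmaOf_le hx M) P := by
  simp only [sigmaOf_eq_sigmaSet]

/-- A sequence driven by the linear dynamics is an invertible linear function of its noise. -/
lemma GovernedBy.noise_mem_span {A B G : ℕ → Matrix (Fin d) (Fin d) ℝ}
    {G0N : Matrix (Fin d) (Fin d) ℝ} (hc : c = 0 ∨ c = N) (h : GovernedBy N c P x A B G0N e G)
    {k : ℕ} (hk : k ≤ N) (a : Fin d) :
    (fun ω => e k ω a) ∈ Submodule.span ℝ (coords x {k | k ≤ N}) := by
  obtain ⟨-, -, -, -, hdyn, h0, hN'⟩ := h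
  set W := Submodule.span ℝ (coords x {k | k ≤ N})
  have hxW : ∀ {l}, l ≤ N → ∀ a, (fun ω => x l ω a) ∈ W := fun hl a =>
    coords_mem_span (K := {k | k ≤ N}) hl a
  have hcN : c ≤ N := by omega
  by_cases hkc : k = c
  · subst hkc
    have : x k = e k := by
      rcases hc with rfl | rfl
      · exact h0 rfl
      · exact (hN' rfl).1
    exact this ▸ hxW hk a
  · rcases Nat.eq_zero_or_pos k with rfl | hk0
    · have he := (hN' (by omega)).2
      have : (fun ω => e 0 ω a) = (fun ω => x 0 ω a) - fun ω => G0N.mulVec (x N ω) a := by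
        ext ω
        simp [he ω]
      exact this ▸ W.sub_mem (hxW hk a) (mulVec_mem (hxW le_rfl) _ a)
    · have he := hdyn k hk0 hk hkc
      have : (fun ω => e k ω a) = (fun ω => x k ω a) -
          ((fun ω => (A k).mulVec (x (k - 1) ω) a) + fun ω => (B k).mulVec (x c ω) a) := by
        ext ω
        simp [he ω]
      exact this ▸ W.sub_mem (hxW hk a)
        (W.add_mem (mulVec_mem (hxW (by omega)) _ a) (mulVec_mem (hxW hcN) _ a))

lemma GovernedBy.mem_span_noise {A B G : ℕ → Matrix (Fin d) (Fin d) ℝ}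
    {G0N : Matrix (Fin d) (Fin d) ℝ} (hc : c = 0 ∨ c = N) (h : GovernedBy N c P x A B G0N e G)
    {j k : ℕ} (hj : j ≤ N) (hk : k ≤ j ∨ k = c) (a : Fin d) :
    (fun ω => x k ω a) ∈ Submodule.span ℝ (coords e {i | i ≤ j ∨ i = c}) := by
  obtain ⟨-, -, -, -, hdyn, h0, hN'⟩ := h
  set V := Submodule.span ℝ (coords e {i | i ≤ j ∨ i = c})
  have heV : ∀ {l}, l ≤ j ∨ l = c → ∀ a, (fun ω => e l ω a) ∈ V := fun hl a =>
    coords_mem_span (K := {i | i ≤ j ∨ i = c}) hl a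
  have hxc : ∀ a, (fun ω => x c ω a) ∈ V := fun a => by
    have : x c = e c := by
      rcases hc with rfl | rfl
      · exact h0 rfl
      · exact (hN' rfl).1
    exact this ▸ heV (.inr rfl) a
  induction k generalizing a with
  | zero =>
    by_cases hc0 : c = 0
    · exact hc0 ▸ hxc a
    · have hcN : c = N := by omega
      have : (fun ω => x 0 ω a) = (fun ω => G0N.mulVec (x c ω) a) + fun ω => e 0 ω a := by
        ext ω
        simp [(hN' hcN).2 ω, hcN]
      exact this ▸ V.add_mem (mulVec_mem hxc _ a) (heV (.inl (Nat.zero_le _)) a)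
  | succ k ih =>
    by_cases hkc : k + 1 = c
    · exact hkc ▸ hxc a
    · have hkj : k + 1 ≤ j := by omega
      have : (fun ω => x (k + 1) ω a) = (fun ω => (A (k + 1)).mulVec (x k ω) a) +
          (fun ω => (B (k + 1)).mulVec (x c ω) a) + fun ω => e (k + 1) ω a := by
        ext ω
        simp [hdyn (k + 1) (by omega) (by omega) hkc ω]
      exact this ▸ V.add_mem (V.add_mem (mulVec_mem (ih (.inl (by omega))) _ a)
        (mulVec_mem hxc _ a)) (heV (.inl hkj) a)

lemma GovernedBy.future_mem_span {A B G : ℕ → Matrix (Fin d) (Fin d) ℝ}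
    {G0N : Matrix (Fin d) (Fin d) ℝ} (h : GovernedBy N c P x A B G0N e G)
    {j k : ℕ} (hjk : j < k) (hk : k ≤ N) (hkc : k ≠ c) (a : Fin d) :
    (fun ω => x k ω a) ∈
      Submodule.span ℝ (coords x {j, c} ∪ coords e {k | j < k ∧ k ≤ N ∧ k ≠ c}) := by
  obtain ⟨-, -, -, -, hdyn, -, -⟩ := h
  set V := Submodule.span ℝ (coords x {j, c} ∪ coords e {k | j < k ∧ k ≤ N ∧ k ≠ c})
  have hV : ∀ {l}, l = j ∨ l = c → ∀ a, (fun ω => x l ω a) ∈ V := fun hl a =>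
    Submodule.subset_span (.inl (mem_coords (K := {j, c}) hl a))
  induction k generalizing a with
  | zero => omega
  | succ k ih =>
    have hxk : ∀ a, (fun ω => x k ω a) ∈ V := fun a => by
      by_cases hkj : k = j ∨ k = c
      · exact hV hkj a
      · exact ih (by omega) (by omega) (by omega) a
    have : (fun ω => x (k + 1) ω a) = (fun ω => (A (k + 1)).mulVec (x k ω) a) +
        (fun ω => (B (k + 1)).mulVec (x c ω) a) + fun ω => e (k + 1) ω a := by
      ext ω
      simp [hdyn (k + 1) (by omega) hk hkc ω]
    exact this ▸ V.add_mem (V.add_mem (mulVec_mem hxk _ a) (mulVec_mem (hV (.inr rfl)) _ a))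
      (Submodule.subset_span (.inr
        (mem_coords (K := {k | j < k ∧ k ≤ N ∧ k ≠ c}) ⟨hjk, hk, hkc⟩ a)))

lemma GovernedBy.isCM [StandardBorelSpace Ω] [IsFiniteMeasure P]
    {A B G : ℕ → Matrix (Fin d) (Fin d) ℝ} {G0N : Matrix (Fin d) (Fin d) ℝ}
    (hc : c = 0 ∨ c = N) (hx : ∀ k, Measurable (x k)) (hZ : IsZMNG N P x)
    (h : GovernedBy N c P x A B G0N e G) : IsCM N c P x hx := by
  intro j hj
  have hW := hZ.isCenteredGaussianSpace hx
  have heW : coords e {k | k ≤ N} ⊆ Submodule.span ℝ (coords x {k | k ≤ N}) := by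
    rintro _ ⟨k, hk, a, rfl⟩
    exact h.noise_mem_span hc hk a
  rw [condIndep_sigmaOf_iff hx]
  refine hW.condIndep_of_integral_mul_eq_zero (E := coords e {k | j < k ∧ k ≤ N ∧ k ≠ c})
    (coords_subset_span ?_) (coords_subset_span fun k hk => (hk.1.trans_le hj).le)
    ((coords_mono fun k hk => hk.2.1).trans heW) ?_ ?_ _
  · rintro k (rfl | rfl)
    · exact hj
    · exact show k ≤ N by omega
  · rintro _ ⟨k, ⟨hjk, hk, hkc⟩, a, rfl⟩
    exact h.future_mem_span hjk hk hkc a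
  · rintro _ ⟨k, ⟨hjk, hk, hkc⟩, a, rfl⟩ g hg
    have hg' : g ∈ Submodule.span ℝ (coords e {i | i ≤ j ∨ i = c}) := by
      rcases hg with ⟨l, hl, b, rfl⟩ | ⟨l, hl, b, rfl⟩
      · exact h.mem_span_noise hc hj (hl.imp_left fun hl => hl.le) b
      · exact h.mem_span_noise hc hj (.inl hl.1.le) b
    refine hW.integral_mul_eq_zero_of_mem_span ((coords_mono fun i hi => ?_).trans heW)
      (h.noise_mem_span hc hk a) ?_ hg'
    · rcases hi with hi | rfl
      · exact hi.trans hj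
      · exact show i ≤ N by omega
    · rintro _ ⟨i, hi, b, rfl⟩
      exact h.2.2.1 k hk i (by rcases hi with hi | hi <;> omega)
        (by rcases hi with hi | hi <;> omega) a b

lemma IsCM.exists_governedBy [StandardBorelSpace Ω] [IsFiniteMeasure P] (hN : 2 ≤ N)
    (hc : c = 0 ∨ c = N) {hx : ∀ k, Measurable (x k)} (hZ : IsZMNG N P x) (h : IsCM N c P x hx) :
    ∃ (A B : ℕ → Matrix (Fin d) (Fin d) ℝ) (G0N : Matrix (Fin d) (Fin d) ℝ)
      (e : ℕ → Ω → (Fin d → ℝ)) (G : ℕ → Matrix (Fin d) (Fin d) ℝ),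
      GovernedBy N c P x A B G0N e G := by
  have hcN : c ≤ N := by omega
  have hW := hZ.isCenteredGaussianSpace hx
  set W := Submodule.span ℝ (coords x {k | k ≤ N})
  have hxW : ∀ {l}, l ≤ N → ∀ a, (fun ω => x l ω a) ∈ W := fun hl a =>
    coords_mem_span (K := {k | k ≤ N}) hl a
  have hreg : ∀ k, ∃ A B : Matrix (Fin d) (Fin d) ℝ, k ≤ N → ∀ a b,
      ∫ ω, (x k ω a - (A.mulVec (x (k - 1) ω) + B.mulVec (x c ω)) a) * x (k - 1) ω b ∂P = 0 ∧
      ∫ ω, (x k ω a - (A.mulVec (x (k - 1) ω) + B.mulVec (x c ω)) a) * x c ω b ∂P = 0 := by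
    intro k
    by_cases hk : k ≤ N
    · obtain ⟨A, B, hAB⟩ := hW.exists_regression (hxW hk)
        (hxW (show k - 1 ≤ N by omega)) (hxW hcN)
      exact ⟨A, B, fun _ => hAB⟩
    · exact ⟨0, 0, fun h => absurd h hk⟩
  choose A B hAB using hreg
  obtain ⟨C, D, hCD⟩ := hW.exists_regression (hxW (Nat.zero_le N)) (hxW le_rfl) (hxW le_rfl)
  let e : ℕ → Ω → (Fin d → ℝ) := fun k => if k = c then x c else
    if k = 0 then fun ω => x 0 ω - (C + D).mulVec (x N ω) else
      fun ω => x k ω - ((A k).mulVec (x (k - 1) ω) + (B k).mulVec (x c ω))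
  have hec : e c = x c := if_pos rfl
  have he0 : 0 ≠ c → e 0 = fun ω => x 0 ω - (C + D).mulVec (x N ω) := fun h0 => by simp [e, h0]
  have hek : ∀ k, k ≠ 0 → k ≠ c →
      e k = fun ω => x k ω - ((A k).mulVec (x (k - 1) ω) + (B k).mulVec (x c ω)) :=
    fun k h0 h1 => by simp [e, h0, h1]
  have hres : ∀ k ≤ N, ∀ a, (fun ω => x k ω a) - (fun ω => e k ω a) ∈
      Submodule.span ℝ (coords x {l | (l ≤ N ∧ l ≠ k) ∧ (l ≤ k ∨ l = c)}) := by
    intro k hk a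
    set V := Submodule.span ℝ (coords x {l | (l ≤ N ∧ l ≠ k) ∧ (l ≤ k ∨ l = c)})
    have hV : ∀ {l}, (l ≤ N ∧ l ≠ k) ∧ (l ≤ k ∨ l = c) → ∀ a, (fun ω => x l ω a) ∈ V :=
      fun hl a => coords_mem_span (K := {l | (l ≤ N ∧ l ≠ k) ∧ (l ≤ k ∨ l = c)}) hl a
    by_cases hkc : k = c
    · rw [hkc, hec, sub_self]
      exact V.zero_mem
    · rcases Nat.eq_zero_or_pos k with rfl | hk0
      · have : (fun ω => x 0 ω a) - (fun ω => e 0 ω a) = fun ω => (C + D).mulVec (x N ω) a := by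
          ext ω
          simp [he0 hkc]
        exact this ▸ mulVec_mem (hV (by omega)) _ a
      · have : (fun ω => x k ω a) - (fun ω => e k ω a) =
            (fun ω => (A k).mulVec (x (k - 1) ω) a) + fun ω => (B k).mulVec (x c ω) a := by
          ext ω
          simp [hek k hk0.ne' hkc]
        exact this ▸ V.add_mem (mulVec_mem (hV (by omega)) _ a) (mulVec_mem (hV (by omega)) _ a)
  have heV : ∀ k ≤ N, ∀ a, (fun ω => e k ω a) ∈
      Submodule.span ℝ (coords x {l | l ≤ N ∧ (l ≤ k ∨ l = c)}) := by
    intro k hk a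
    set K := {l | l ≤ N ∧ (l ≤ k ∨ l = c)} with hK
    have := Submodule.sub_mem (Submodule.span ℝ (coords x K))
      (coords_mem_span (hK ▸ ⟨hk, .inl le_rfl⟩ : k ∈ K) a)
      (Submodule.span_mono (coords_mono fun l hl => hK ▸ ⟨hl.1.1, hl.2⟩) (hres k hk a))
    rwa [sub_sub_cancel] at this
  have heW : ∀ k ≤ N, ∀ a, (fun ω => e k ω a) ∈ W := fun k hk a =>
    Submodule.span_mono (coords_mono fun l hl => hl.1) (heV k hk a)
  have horth : ∀ k ≤ N, k ≠ c → ∀ l ≤ N, l < k ∨ l = c → ∀ a b,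
      ∫ ω, e k ω a * x l ω b ∂P = 0 := by
    intro k hk hkc l hl hlk a b
    rcases Nat.eq_zero_or_pos k with rfl | hk0
    · have hlN : l = N := by omega
      subst hlN
      rw [he0 hkc]
      simpa [Matrix.add_mulVec] using (hCD a b).1
    · rw [hek k hk0.ne' hkc]
      by_cases hlc : l = c
      · subst hlc
        exact (hAB k hk a b).2
      by_cases hlk' : l = k - 1
      · subst hlk'
        exact (hAB k hk a b).1
      have hci := (condIndep_sigmaOf_iff hx _ _ _).1 (h (k - 1) (by omega))
      refine hW.integral_mul_eq_zero_of_condIndep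
        (p := fun ω => ((A k).mulVec (x (k - 1) ω) + (B k).mulVec (x c ω)) a)
        (coords_subset_span ?_) (coords_subset_span fun k hk => hk.2.1)
        (coords_subset_span fun l hl => ?_) hci
        (mem_coords (K := {m | k - 1 < m ∧ m ≤ N ∧ m ≠ c}) ⟨by omega, hk, hkc⟩ a)
        (mem_coords (K := {m | m < k - 1 ∧ m ≠ c}) ⟨by omega, hlc⟩ b) ?_ ?_
      · intro m hm
        have hm' : m = k - 1 ∨ m = c := hm
        exact show m ≤ N by omega
      · have := hl.1
        exact show l ≤ N by omega
      · exact Submodule.add_mem (Submodule.span ℝ (coords x {k - 1, c}))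
          (x := fun ω => (A k).mulVec (x (k - 1) ω) a) (y := fun ω => (B k).mulVec (x c ω) a)
          (mulVec_mem (y := x (k - 1)) (coords_mem_span (Set.mem_insert _ _)) (A k) a)
          (mulVec_mem (y := x c)
            (coords_mem_span (Set.mem_insert_of_mem _ (Set.mem_singleton c))) (B k) a)
      · rintro _ ⟨m, hm, b, rfl⟩
        rcases (show m = k - 1 ∨ m = c from hm) with hm | hm
        · rw [hm]
          exact (hAB k hk a b).1
        · rw [hm]
          exact (hAB k hk a b).2
  have hwhite : ∀ k ≤ N, k ≠ c → ∀ i ≤ N, i < k ∨ i = c → ∀ a b,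
      ∫ ω, e k ω a * e i ω b ∂P = 0 := by
    intro k hk hkc i hi hik a b
    by_cases hic : i = c
    · rw [hic, hec]
      exact horth k hk hkc c hcN (.inr rfl) a b
    refine hW.integral_mul_eq_zero_of_mem_span (coords_subset_span fun l hl => hl.1)
      (heW k hk a) ?_ (heV i hi b)
    rintro _ ⟨l, ⟨hl, hli⟩, b, rfl⟩
    exact horth k hk hkc l hl (by omega) a b
  refine ⟨A, B, C + D, e, fun k => Matrix.of fun a b => ∫ ω, e k ω a * e k ω b ∂P,
    fun w => ?_, fun k hk a => hW.integral_eq_zero _ (heW k hk a), fun k hk i hi hki a b => ?_,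
    fun k hk => ⟨fun a b => rfl, hZ.posDef_residual hx hk fun a =>
      Submodule.span_mono (coords_mono fun l hl => hl.1) (hres k hk a)⟩,
    fun k hk0 hk hkc ω => ?_, ?_, ?_⟩
  · have : (fun ω => ∑ i, w i * Sum.elim (stacked N x ω) (stacked N e ω) i) ∈ W := by
      have hsum : (fun ω => ∑ i, w i * Sum.elim (stacked N x ω) (stacked N e ω) i)
          = ∑ i, w i • fun ω => Sum.elim (stacked N x ω) (stacked N e ω) i := by
        ext ω
        simp
      rw [hsum]
      refine W.sum_mem fun i _ => W.smul_mem _ ?_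
      rcases i with p | p
      · exact hxW (Nat.le_of_lt_succ p.1.2) p.2
      · exact heW _ (Nat.le_of_lt_succ p.1.2) p.2
    exact ⟨_, _, (hW.hasGaussianLaw this).map_eq_gaussianReal⟩
  · by_cases hik : k ≠ c ∧ (i < k ∨ i = c)
    · exact hwhite k hk hik.1 i hi hik.2 a b
    · simp_rw [mul_comm (e k _ a)]
      exact hwhite i hi (by omega) k hk (by omega) b a
  · simp [hek k (by omega) hkc]
  · rintro rfl
    exact hec.symm
  · rintro rfl
    exact ⟨hec.symm, fun ω => by simp [he0 (by omega)]⟩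

end governed

/-- a ZMNG sequence is `CM_c` iff it is governed by some `CM_c` model. -/
theorem stmt_9 [MeasurableSpace Ω] [StandardBorelSpace Ω]
    (N d c : ℕ) (hN : 2 ≤ N) (hd : 1 ≤ d) (hc : c = 0 ∨ c = N)
    (P : Measure Ω) [IsProbabilityMeasure P]
    (x : ℕ → Ω → (Fin d → ℝ)) (hx : ∀ k, Measurable (x k))
    (hZMNG : IsZMNG N P x) :
    IsCM N c P x hx ↔
      ∃ (A B : ℕ → Matrix (Fin d) (Fin d) ℝ) (G0N : Matrix (Fin d) (Fin d) ℝ)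
        (e : ℕ → Ω → (Fin d → ℝ)) (G : ℕ → Matrix (Fin d) (Fin d) ℝ),
        GovernedBy N c P x A B G0N e G := by
  exact ⟨fun h => h.exists_governedBy hN hc hZMNG, fun ⟨_, _, _, _, _, h⟩ => h.isCM hc hx hZMNG⟩
end
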